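/- arXiv:1908.09347 — 2 statements merged into one kernel-verified Lean document; each statement's English description precedes it below -/
import Mathlib

section
/- Let A be an m×m matrix with integer entries, acting on ℝ^m, and let K ∈ ℤ^m. Then the set of lattice points K' ∈ ℤ^m for which there exists x ∈ ℝ^m with ‖x − K‖_∞ ≤ 1/2 and ‖Ax − K'‖_∞ ≤ 1/2 has cardinality at most (2 + ‖A‖)^m. -/
/-- If `x` lies within `1/2` of `K` and `A x` within `1/2` of `K'`, then each coordinate of `K'`
is within `(1 + ∑ j, |A i j|) / 2` of the corresponding coordinate of `A K`. -/
theorem two_mul_abs_sub_mulVec_le {m : ℕ} (A : Matrix (Fin m) (Fin m) ℤ) (K K' : Fin m → ℤ)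
    (x : Fin m → ℝ) (hx : ∀ i, |x i - (K i : ℝ)| ≤ 1 / 2) (i : Fin m)
    (hi : |(A.map (fun n => (n : ℝ))).mulVec x i - (K' i : ℝ)| ≤ 1 / 2) :
    2 * |K' i - A.mulVec K i| ≤ 1 + ∑ j, |A i j| := by
  have hdiff : |(A.map (fun n => (n : ℝ))).mulVec x i - ((A.mulVec K i : ℤ) : ℝ)|
      ≤ (∑ j, |(A i j : ℝ)|) * (1 / 2) := by
    simp only [Matrix.mulVec, dotProduct, Matrix.map_apply, Int.cast_sum, Int.cast_mul]
    rw [← Finset.sum_sub_distrib, Finset.sum_mul]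
    refine (Finset.abs_sum_le_sum_abs _ _).trans (Finset.sum_le_sum fun j _ => ?_)
    rw [← mul_sub, abs_mul]
    exact mul_le_mul_of_nonneg_left (hx j) (abs_nonneg _)
  have htri := abs_sub_le (K' i : ℝ) ((A.map (fun n => (n : ℝ))).mulVec x i)
    ((A.mulVec K i : ℤ) : ℝ)
  rw [abs_sub_comm] at hi
  have hreal : 2 * |(K' i : ℝ) - ((A.mulVec K i : ℤ) : ℝ)| ≤ 1 + ∑ j, |(A i j : ℝ)| := by
    linarith
  exact_mod_cast hreal


/-- Let `A` be an `m×m` integer matrix acting on `ℝ^m` and `K ∈ ℤ^m`.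
The set of lattice points `K' ∈ ℤ^m` for which there is `x ∈ ℝ^m` with
`‖x - K‖_∞ ≤ 1/2` and `‖Ax - K'‖_∞ ≤ 1/2` is finite, of cardinality at most
`(2 + ‖A‖)^m`, where `‖A‖ = max_i Σ_j |A_{ij}|` is the `ℓ∞` operator norm. -/
theorem stmt4 {m : ℕ} (A : Matrix (Fin m) (Fin m) ℤ) (K : Fin m → ℤ)
    (S : Set (Fin m → ℤ))
    (hS : S = {K' : Fin m → ℤ | ∃ x : Fin m → ℝ,
        (∀ i, |x i - (K i : ℝ)| ≤ 1 / 2) ∧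
        (∀ i, |(A.map (fun n => (n : ℝ))).mulVec x i - (K' i : ℝ)| ≤ 1 / 2)}) :
    S.Finite ∧ (S.ncard : ℝ) ≤ (2 + ⨆ i : Fin m, ∑ j, |(A i j : ℝ)|) ^ m := by
  classical
  set B : Finset (Fin m → ℤ) := Fintype.piFinset fun i =>
    Finset.Icc (A.mulVec K i - (1 + ∑ j, |A i j|) / 2) (A.mulVec K i + (1 + ∑ j, |A i j|) / 2)
    with hB
  have hSB : S ⊆ (B : Set (Fin m → ℤ)) := by
    rw [hS]
    rintro K' ⟨x, hx, hAx⟩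
    rw [Finset.mem_coe, hB, Fintype.mem_piFinset]
    intro i
    have h := two_mul_abs_sub_mulVec_le A K K' x hx i (hAx i)
    have hle := le_abs_self (K' i - A.mulVec K i)
    have hge := neg_abs_le (K' i - A.mulVec K i)
    rw [Finset.mem_Icc]
    omega
  refine ⟨B.finite_toSet.subset hSB, ?_⟩
  have hcard : (S.ncard : ℝ) ≤ B.card := by
    rw [← Set.ncard_coe_finset B]
    exact_mod_cast Set.ncard_le_ncard hSB B.finite_toSet
  refine hcard.trans ?_
  rw [hB, Fintype.card_piFinset, Nat.cast_prod]
  calc _ ≤ ∏ _i : Fin m, (2 + ⨆ i : Fin m, ∑ j, |(A i j : ℝ)|) := by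
        refine Finset.prod_le_prod (fun _ _ => Nat.cast_nonneg _) fun i _ => ?_
        have hsup : ∑ j, |(A i j : ℝ)| ≤ ⨆ i : Fin m, ∑ j, |(A i j : ℝ)| :=
          le_ciSup (f := fun i : Fin m => ∑ j, |(A i j : ℝ)|) (Set.finite_range _).bddAbove i
        have hnonneg : 0 ≤ ∑ j, |A i j| := Finset.sum_nonneg fun _ _ => abs_nonneg _
        have hint : ((Finset.Icc (A.mulVec K i - (1 + ∑ j, |A i j|) / 2)
            (A.mulVec K i + (1 + ∑ j, |A i j|) / 2)).card : ℤ) ≤ 2 + ∑ j, |A i j| := by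
          rw [Int.card_Icc]
          omega
        have hreal : ((Finset.Icc (A.mulVec K i - (1 + ∑ j, |A i j|) / 2)
            (A.mulVec K i + (1 + ∑ j, |A i j|) / 2)).card : ℝ) ≤ 2 + ∑ j, |(A i j : ℝ)| := by
          exact_mod_cast hint
        linarith
    _ = _ := by simp
end

section
/- Let Y be a set and h : ℝ × Y → Y a map. Let θ₁ > 0, γ ∈ (0,1), L ≥ 0, C₀ ≥ 0, ℓ₂ ∈ ℕ, and Λ ⊆ ℝ. Let f : Y → ℂ be bounded, and suppose that for every integer ℓ ≥ ℓ₂ there exists g_ℓ : Y → ℂ such that: (i) sup_{y∈Y} |f(y) − g_ℓ(y)| ≤ L e^{−θ₁ℓ/2}; (ii) for each y ∈ Y the maps τ ↦ f(h(τ,y)) and τ ↦ g_ℓ(h(τ,y)) are measurable on [0,∞); and (iii) |S_R^{(y)}(g_ℓ, ω)| ≤ C₀ R^{1−γ/2} for all ω ∈ Λ, all y ∈ Y and all R ≥ e^{θ₁ℓ/γ}. Then |S_R^{(y)}(f, ω)| ≤ (C₀ + e^{θ₁/2} L) R^{1−γ/2} for all ω ∈ Λ, all y ∈ Y and all R ≥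 e^{θ₁ℓ₂/γ}. -/
open MeasureTheory in
lemma intervalIntegrable_twist_mul (ω : ℝ) {u : ℝ → ℂ} {R M : ℝ} (hR : 0 ≤ R)
    (hu : Measurable ((Set.Ici (0 : ℝ)).domRestrict u)) (hM : ∀ τ, ‖u τ‖ ≤ M) :
    IntervalIntegrable (fun τ : ℝ =>
      Complex.exp (-(2 * (Real.pi : ℂ) * (ω : ℂ) * (τ : ℂ)) * Complex.I) * u τ) volume 0 R := by
  have hu_int : IntervalIntegrable u volume 0 R := by
    rw [intervalIntegrable_iff_integrableOn_Icc_of_le hR]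
    have hae : AEMeasurable u (volume.restrict (Set.Ici (0 : ℝ))) :=
      aemeasurable_restrict_of_measurable_subtype measurableSet_Ici hu
    exact (integrable_const M).mono'
      (hae.mono_measure (Measure.restrict_mono Set.Icc_subset_Ici_self le_rfl)).aestronglyMeasurable
      (Filter.Eventually.of_forall hM)
  exact hu_int.continuousOn_mul (by fun_prop)

lemma norm_twist (ω τ : ℝ) :
    ‖Complex.exp (-(2 * (Real.pi : ℂ) * (ω : ℂ) * (τ : ℂ)) * Complex.I)‖ = 1 := by
  simpa using Complex.norm_exp_ofReal_mul_I (-(2 * Real.pi * ω * τ))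

/-- Transfer of power-law bounds on twisted Birkhoff integrals
`S_R^{(y)}(g, ω) = ∫₀^R e^{-2πiωτ} g(h(τ,y)) dτ` from a family of approximating
functions `g_ℓ` (with `sup |f - g_ℓ| ≤ L e^{-θ₁ℓ/2}`) to `f` itself:
`|S_R^{(y)}(f, ω)| ≤ (C₀ + e^{θ₁/2} L) R^{1-γ/2}` for all `ω ∈ Λ`, `y ∈ Y`,
`R ≥ e^{θ₁ℓ₂/γ}`. -/
theorem stmt8 {Y : Type*} (h : ℝ × Y → Y)
    (θ₁ : ℝ) (hθ : 0 < θ₁) (γ : ℝ) (hγ : γ ∈ Set.Ioo (0 : ℝ) 1)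
    (L : ℝ) (hL : 0 ≤ L) (C₀ : ℝ) (hC₀ : 0 ≤ C₀) (ℓ₂ : ℕ) (Λ : Set ℝ)
    (f : Y → ℂ) (hfb : ∃ M : ℝ, ∀ y, ‖f y‖ ≤ M)
    (happrox : ∀ ℓ : ℕ, ℓ₂ ≤ ℓ → ∃ g : Y → ℂ,
      (∀ y, ‖f y - g y‖ ≤ L * Real.exp (-θ₁ * (ℓ : ℝ) / 2)) ∧
      (∀ y, Measurable ((Set.Ici (0 : ℝ)).restrict fun τ => f (h (τ, y))) ∧
            Measurable ((Set.Ici (0 : ℝ)).restrict fun τ => g (h (τ, y)))) ∧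
      (∀ ω ∈ Λ, ∀ y, ∀ R : ℝ, Real.exp (θ₁ * (ℓ : ℝ) / γ) ≤ R →
        ‖∫ τ in (0 : ℝ)..R,
            Complex.exp (-(2 * (Real.pi : ℂ) * (ω : ℂ) * (τ : ℂ)) * Complex.I)
              * g (h (τ, y))‖
          ≤ C₀ * R ^ (1 - γ / 2))) :
    ∀ ω ∈ Λ, ∀ y, ∀ R : ℝ, Real.exp (θ₁ * (ℓ₂ : ℝ) / γ) ≤ R →
      ‖∫ τ in (0 : ℝ)..R,
          Complex.exp (-(2 * (Real.pi : ℂ) * (ω : ℂ) * (τ : ℂ)) * Complex.I)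
            * f (h (τ, y))‖
        ≤ (C₀ + Real.exp (θ₁ / 2) * L) * R ^ (1 - γ / 2) := by
  intro ω hω y R hR
  obtain ⟨hγ0, -⟩ := hγ
  obtain ⟨M, hM⟩ := hfb
  have hR0 : 0 < R := (Real.exp_pos _).trans_le hR
  have hlog : θ₁ * ℓ₂ / γ ≤ Real.log R := (Real.le_log_iff_exp_le hR0).2 hR
  have hℓ₂ : (ℓ₂ : ℝ) ≤ γ * Real.log R / θ₁ := by
    rw [div_le_iff₀ hγ0] at hlog
    rw [le_div_iff₀ hθ]
    linarith
  obtain ⟨g, hfg, hmeas, hg⟩ := happrox ⌊γ * Real.log R / θ₁⌋₊ (Nat.le_floor hℓ₂)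
  have hfloor_le := Nat.floor_le (ℓ₂.cast_nonneg.trans hℓ₂)
  have hlt_floor := Nat.lt_floor_add_one (γ * Real.log R / θ₁)
  set ℓ := ⌊γ * Real.log R / θ₁⌋₊
  rw [le_div_iff₀ hθ] at hfloor_le
  rw [div_lt_iff₀ hθ] at hlt_floor
  have hRℓ : Real.exp (θ₁ * ℓ / γ) ≤ R := by
    rw [← Real.le_log_iff_exp_le hR0, div_le_iff₀ hγ0]
    linarith
  have hexp : Real.exp (-θ₁ * ℓ / 2) * R ≤ Real.exp (θ₁ / 2) * R ^ (1 - γ / 2) := by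
    rw [Real.rpow_def_of_pos hR0, ← Real.exp_add]
    nth_rw 1 [← Real.exp_log hR0]
    rw [← Real.exp_add, Real.exp_le_exp]
    linarith
  set ε := L * Real.exp (-θ₁ * ℓ / 2)
  have hgM : ∀ z, ‖g z‖ ≤ M + ε := fun z => by
    have := norm_sub_norm_le (g z) (f z)
    rw [norm_sub_rev] at this
    linarith [hM z, hfg z]
  have hf_int := intervalIntegrable_twist_mul ω hR0.le (hmeas y).1 fun τ => hM (h (τ, y))
  have hg_int := intervalIntegrable_twist_mul ω hR0.le (hmeas y).2 fun τ => hgM (h (τ, y))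
  have hdiff : ‖(∫ τ in (0 : ℝ)..R,
        Complex.exp (-(2 * (Real.pi : ℂ) * (ω : ℂ) * (τ : ℂ)) * Complex.I) * f (h (τ, y))) -
      ∫ τ in (0 : ℝ)..R,
        Complex.exp (-(2 * (Real.pi : ℂ) * (ω : ℂ) * (τ : ℂ)) * Complex.I) * g (h (τ, y))‖
      ≤ ε * R := by
    rw [← intervalIntegral.integral_sub hf_int hg_int]
    refine (intervalIntegral.norm_integral_le_of_norm_le_const (C := ε) fun τ _ => ?_).trans ?_
    · rw [← mul_sub, norm_mul, norm_twist, one_mul]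
      exact hfg _
    · rw [sub_zero, abs_of_pos hR0]
  calc _ ≤ C₀ * R ^ (1 - γ / 2) + ε * R :=
        (norm_le_norm_add_norm_sub' _ _).trans (add_le_add (hg ω hω y R hRℓ) hdiff)
    _ ≤ (C₀ + Real.exp (θ₁ / 2) * L) * R ^ (1 - γ / 2) := by
        have := mul_le_mul_of_nonneg_left hexp hL
        simp only [ε]
        linarith
end
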